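/- Isolated critical points: Let J be an almost complex structure on ℂⁿ, U ⊆ ℂ a connected open set, and u : U → ℂⁿ a smooth nonconstant J-holomorphic curve. Then the critical set Crit(u) = { z ∈ U : Du(z) = 0 }, where Du(z) denotes the real Fréchet derivative of u at z, is discrete: it has no accumulation point in U. -/

import Mathlib

open Metric Complex

section PseudoholomorphicCurves

open MeasureTheory Set Filter Topology

theorem integral_fderiv_apply_eq_zero {f : ℂ → ℝ} (hf : ContDiff ℝ 1 f)
    (hc : HasCompactSupport f) (v : ℂ) : ∫ z, fderiv ℝ f z v = 0 := by
  have hd : Continuous fun z ↦ fderiv ℝ f z v :=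
    (hf.continuous_fderiv one_ne_zero).clm_apply continuous_const
  have hi : Integrable fun z ↦ fderiv ℝ f z v :=
    hd.integrable_of_hasCompactSupport (hc.fderiv_apply ℝ v)
  have := integral_mul_fderiv_eq_neg_fderiv_mul_of_integrable (μ := volume) (𝕜 := ℝ)
    (f := fun _ : ℂ ↦ (1 : ℝ)) (g := f) (v := v) (by simp)
    (by simpa using hi) (by simpa using hf.continuous.integrable_of_hasCompactSupport hc)
    (by simp) (fun x _ ↦ hf.differentiable one_ne_zero x)
  simpa using this

theorem carleman_aux {a b : ℂ → ℝ} (ha : ContDiff ℝ 2 a) (hb : ContDiff ℝ 2 b)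
    (hac : HasCompactSupport a) (hbc : HasCompactSupport b) (N : ℝ) :
    4 * N * ∫ z, (a z ^ 2 + b z ^ 2) ≤
      ∫ z, ((fderiv ℝ a z 1 - fderiv ℝ b z I - N * (z.re * a z - z.im * b z)) ^ 2 +
        (fderiv ℝ b z 1 + fderiv ℝ a z I - N * (z.im * a z + z.re * b z)) ^ 2) := by
  have ha1 : ∀ v : ℂ, ContDiff ℝ 1 fun z ↦ fderiv ℝ a z v := fun v ↦
    (ha.fderiv_right (m := 1) (by norm_num)).clm_apply contDiff_const
  have hb1 : ∀ v : ℂ, ContDiff ℝ 1 fun z ↦ fderiv ℝ b z v := fun v ↦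
    (hb.fderiv_right (m := 1) (by norm_num)).clm_apply contDiff_const
  have ha' : ContDiff ℝ 1 a := ha.of_le (by norm_num)
  have hb' : ContDiff ℝ 1 b := hb.of_le (by norm_num)
  have hre : ContDiff ℝ 1 fun z : ℂ ↦ z.re := reCLM.contDiff
  have him : ContDiff ℝ 1 fun z : ℂ ↦ z.im := imCLM.contDiff
  set P : ℂ → ℝ := fun z ↦ b z * fderiv ℝ a z I - N / 2 * (z.re * (a z ^ 2 + b z ^ 2)) with hP
  set Q : ℂ → ℝ := fun z ↦ -(b z * fderiv ℝ a z 1) - N / 2 * (z.im * (a z ^ 2 + b z ^ 2)) with hQ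
  have hP1 : ContDiff ℝ 1 P := by
    have := ha1 I
    fun_prop
  have hQ1 : ContDiff ℝ 1 Q := by
    have := ha1 1
    fun_prop
  have hsupp : ∀ {f : ℂ → ℝ}, (∀ z, a z = 0 → b z = 0 → f z = 0) → HasCompactSupport f := by
    intro f hf
    refine HasCompactSupport.intro (hac.isCompact.union hbc.isCompact) fun z hz ↦ hf z ?_ ?_
    · exact image_eq_zero_of_notMem_tsupport fun h ↦ hz (Or.inl h)
    · exact image_eq_zero_of_notMem_tsupport fun h ↦ hz (Or.inr h)
  have hPc : HasCompactSupport P := hsupp fun z h1 h2 ↦ by simp [hP, h1, h2]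
  have hQc : HasCompactSupport Q := hsupp fun z h1 h2 ↦ by simp [hQ, h1, h2]
  have hPi := integral_fderiv_apply_eq_zero hP1 hPc 1
  have hQi := integral_fderiv_apply_eq_zero hQ1 hQc I
  have hsymm : ∀ z, fderiv ℝ (fun w ↦ fderiv ℝ a w I) z 1 = fderiv ℝ (fun w ↦ fderiv ℝ a w 1) z I := by
    intro z
    have h := (ha.contDiffAt (x := z)).isSymmSndFDerivAt (by simp)
    have hda : DifferentiableAt ℝ (fderiv ℝ a) z :=
      (ha.fderiv_right (m := 1) (by norm_num)).differentiable one_ne_zero z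
    have e : ∀ v w : ℂ, fderiv ℝ (fun x ↦ fderiv ℝ a x v) z w = fderiv ℝ (fderiv ℝ a) z w v := by
      intro v w
      rw [fderiv_clm_apply hda (by fun_prop)]
      simp
    rw [e, e, h.eq]
  have dP : ∀ z, fderiv ℝ P z 1 = fderiv ℝ b z 1 * fderiv ℝ a z I
      + b z * fderiv ℝ (fun w ↦ fderiv ℝ a w I) z 1
      - N / 2 * (a z ^ 2 + b z ^ 2 + z.re * (2 * a z * fderiv ℝ a z 1 + 2 * b z * fderiv ℝ b z 1)) := by
    intro z
    have h1 := (ha'.differentiable one_ne_zero z).hasFDerivAt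
    have h2 := (hb'.differentiable one_ne_zero z).hasFDerivAt
    have h3 := ((ha1 I).differentiable one_ne_zero z).hasFDerivAt
    have h4 := (reCLM.hasFDerivAt (x := z))
    have := ((h2.mul h3).sub ((h4.mul ((h1.pow 2).add (h2.pow 2))).const_mul (N/2))).fderiv
    have e : P = _ := hP
    rw [e]
    refine (DFunLike.congr_fun this _).trans ?_
    simp
    ring
  have dQ : ∀ z, fderiv ℝ Q z I = - (fderiv ℝ b z I * fderiv ℝ a z 1
      + b z * fderiv ℝ (fun w ↦ fderiv ℝ a w 1) z I)
      - N / 2 * (a z ^ 2 + b z ^ 2 + z.im * (2 * a z * fderiv ℝ a z I + 2 * b z * fderiv ℝ b z I)) := by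
    intro z
    have h1 := (ha'.differentiable one_ne_zero z).hasFDerivAt
    have h2 := (hb'.differentiable one_ne_zero z).hasFDerivAt
    have h3 := ((ha1 1).differentiable one_ne_zero z).hasFDerivAt
    have h4 := (imCLM.hasFDerivAt (x := z))
    have := ((h2.mul h3).neg.sub ((h4.mul ((h1.pow 2).add (h2.pow 2))).const_mul (N/2))).fderiv
    have e : Q = _ := hQ
    rw [e]
    refine (DFunLike.congr_fun this _).trans ?_
    simp
    ring
  have ca := fun v ↦ (ha1 v).continuous
  have cb := fun v ↦ (hb1 v).continuous
  have ca0 := ha.continuous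
  have cb0 := hb.continuous
  have hda0 : ∀ z v, z ∉ tsupport a → fderiv ℝ a z v = 0 := fun z v hz ↦ by
    rw [fderiv_of_notMem_tsupport ℝ hz]; rfl
  have hdb0 : ∀ z v, z ∉ tsupport b → fderiv ℝ b z v = 0 := fun z v hz ↦ by
    rw [fderiv_of_notMem_tsupport ℝ hz]; rfl
  have i1 : Integrable fun z ↦ a z ^ 2 + b z ^ 2 :=
    Continuous.integrable_of_hasCompactSupport (by fun_prop) (hsupp fun z h1 h2 ↦ by simp [h1, h2])
  have i2 : Integrable fun z ↦ fderiv ℝ P z 1 :=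
    ((hP1.continuous_fderiv one_ne_zero).clm_apply continuous_const).integrable_of_hasCompactSupport
      (hPc.fderiv_apply ℝ 1)
  have i3 : Integrable fun z ↦ fderiv ℝ Q z I :=
    ((hQ1.continuous_fderiv one_ne_zero).clm_apply continuous_const).integrable_of_hasCompactSupport
      (hQc.fderiv_apply ℝ I)
  have i4 : Integrable fun z : ℂ ↦
      ((fderiv ℝ a z 1 - fderiv ℝ b z I - N * (z.re * a z - z.im * b z)) ^ 2 +
        (fderiv ℝ b z 1 + fderiv ℝ a z I - N * (z.im * a z + z.re * b z)) ^ 2) := by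
    refine Continuous.integrable_of_hasCompactSupport ?_ ?_
    · have := ca 1; have := ca I; have := cb 1; have := cb I
      fun_prop
    · refine HasCompactSupport.intro (hac.isCompact.union hbc.isCompact) fun z hz ↦ ?_
      have h1 : z ∉ tsupport a := fun h ↦ hz (Or.inl h)
      have h2 : z ∉ tsupport b := fun h ↦ hz (Or.inr h)
      simp [hda0 z _ h1, hdb0 z _ h2, image_eq_zero_of_notMem_tsupport h1,
        image_eq_zero_of_notMem_tsupport h2]
  have i5 : Integrable fun z ↦ 4 * fderiv ℝ P z 1 + 4 * fderiv ℝ Q z I :=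
    (i2.const_mul _).add (i3.const_mul _)
  have key : ∫ z, (4 * N * (a z ^ 2 + b z ^ 2) + (4 * fderiv ℝ P z 1 + 4 * fderiv ℝ Q z I)) =
      4 * N * ∫ z, (a z ^ 2 + b z ^ 2) := by
    rw [integral_add (i1.const_mul _) i5,
      integral_add (i2.const_mul _) (i3.const_mul _), integral_const_mul, integral_const_mul,
      integral_const_mul, hPi, hQi]
    ring
  rw [← key]
  refine integral_mono ((i1.const_mul _).add i5) i4 fun z ↦ ?_
  simp only [dP, dQ, hsymm]
  nlinarith [sq_nonneg (fderiv ℝ a z 1 + fderiv ℝ b z I + N * (z.re * a z + z.im * b z)),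
    sq_nonneg (fderiv ℝ b z 1 - fderiv ℝ a z I + N * (z.re * b z - z.im * a z))]

theorem carleman_gaussian {g : ℂ → ℂ} (hg : ContDiff ℝ 2 g) (hc : HasCompactSupport g) (N : ℝ) :
    4 * N * ∫ z, ‖g z‖ ^ 2 * Real.exp (N * ‖z‖ ^ 2) ≤
      ∫ z, ‖fderiv ℝ g z 1 + I * fderiv ℝ g z I‖ ^ 2 * Real.exp (N * ‖z‖ ^ 2) := by
  set e : ℂ → ℝ := fun z ↦ Real.exp (N / 2 * (z.re ^ 2 + z.im ^ 2)) with he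
  have hre : ContDiff ℝ 2 fun z : ℂ ↦ z.re := reCLM.contDiff
  have him : ContDiff ℝ 2 fun z : ℂ ↦ z.im := imCLM.contDiff
  have hgre : ContDiff ℝ 2 fun z : ℂ ↦ (g z).re := reCLM.contDiff.comp hg
  have hgim : ContDiff ℝ 2 fun z : ℂ ↦ (g z).im := imCLM.contDiff.comp hg
  have hes : ContDiff ℝ 2 e := by fun_prop
  have hesq : ∀ z, Real.exp (N * ‖z‖ ^ 2) = e z ^ 2 := fun z ↦ by
    rw [he, ← Real.exp_nat_mul, Complex.sq_norm, normSq_apply]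
    congr 1
    push_cast
    ring
  have hde : ∀ z v, fderiv ℝ e z v = e z * (N * (z.re * v.re + z.im * v.im)) := fun z v ↦ by
    have h1 := (reCLM.hasFDerivAt (x := z))
    have h2 := (imCLM.hasFDerivAt (x := z))
    have := (((h1.pow 2).add (h2.pow 2)).const_mul (N / 2)).exp.fderiv
    rw [he]
    refine (DFunLike.congr_fun this v).trans ?_
    simp
    ring
  have hd : ∀ z, HasFDerivAt g (fderiv ℝ g z) z := fun z ↦
    (hg.differentiable two_ne_zero z).hasFDerivAt
  have hda : ∀ z v, fderiv ℝ (fun z ↦ e z * (g z).re) z v =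
      e z * (fderiv ℝ g z v).re + e z * (N * (z.re * v.re + z.im * v.im)) * (g z).re := fun z v ↦ by
    have h1 := (hes.differentiable two_ne_zero z).hasFDerivAt
    have h2 := (reCLM.hasFDerivAt (x := g z)).comp z (hd z)
    refine (DFunLike.congr_fun (h1.mul h2).fderiv v).trans ?_
    simp [hde]
    ring
  have hdb : ∀ z v, fderiv ℝ (fun z ↦ e z * (g z).im) z v =
      e z * (fderiv ℝ g z v).im + e z * (N * (z.re * v.re + z.im * v.im)) * (g z).im := fun z v ↦ by
    have h1 := (hes.differentiable two_ne_zero z).hasFDerivAt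
    have h2 := (imCLM.hasFDerivAt (x := g z)).comp z (hd z)
    refine (DFunLike.congr_fun (h1.mul h2).fderiv v).trans ?_
    simp [hde]
    ring
  have h0 : ∀ z, z ∉ tsupport g → g z = 0 := fun z hz ↦ image_eq_zero_of_notMem_tsupport hz
  have := carleman_aux (hes.mul hgre) (hes.mul hgim)
    (HasCompactSupport.intro hc.isCompact fun z hz ↦ by simp [h0 z hz])
    (HasCompactSupport.intro hc.isCompact fun z hz ↦ by simp [h0 z hz]) N
  refine Eq.trans_le (congrArg (4 * N * ·) (integral_congr_ae (.of_forall fun z ↦ ?_)))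
    (this.trans_eq (integral_congr_ae (.of_forall fun z ↦ ?_)))
  · simp only
    rw [hesq, Complex.sq_norm, normSq_apply]
    ring
  · simp only
    rw [hesq, Complex.sq_norm, normSq_apply, hda, hda, hdb, hdb]
    simp
    ring

/-- The weight of the Carleman estimate: singular of order `2 * m` at the origin. -/
noncomputable def carlemanWeight (m : ℕ) (N : ℝ) (z : ℂ) : ℝ :=
  (‖z‖ ^ m)⁻¹ ^ 2 * Real.exp (N * ‖z‖ ^ 2)

theorem carlemanWeight_nonneg (m : ℕ) (N : ℝ) (z : ℂ) : 0 ≤ carlemanWeight m N z := by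
  unfold carlemanWeight
  positivity

theorem continuousAt_carlemanWeight (m : ℕ) (N : ℝ) {z : ℂ} (hz : z ≠ 0) :
    ContinuousAt (carlemanWeight m N) z := by
  have : ‖z‖ ^ m ≠ 0 := by positivity
  unfold carlemanWeight
  fun_prop (disch := assumption)

theorem integrable_mul_carlemanWeight {h : ℂ → ℝ} (hh : Continuous h) {K : Set ℂ}
    (hK : IsCompact K) (h0 : (0 : ℂ) ∉ K) (hs : ∀ z ∉ K, h z = 0) (m : ℕ) (N : ℝ) :
    Integrable fun z ↦ h z * carlemanWeight m N z := by
  refine Continuous.integrable_of_hasCompactSupport ?_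
    (HasCompactSupport.intro hK fun z hz ↦ by simp [hs z hz])
  rw [continuous_iff_continuousAt]
  intro z
  by_cases hz : z = 0
  · have : (fun z ↦ h z * carlemanWeight m N z) =ᶠ[𝓝 z] fun _ ↦ (0 : ℝ) := by
      rw [hz]
      filter_upwards [hK.isClosed.isOpen_compl.mem_nhds h0] with z hz
      simp [hs z hz]
    exact continuousAt_const.congr this.symm
  · exact hh.continuousAt.mul (continuousAt_carlemanWeight m N hz)

theorem carleman_scalar {f : ℂ → ℂ} (hf : ContDiff ℝ 2 f) (hc : HasCompactSupport f)
    (h0 : (0 : ℂ) ∉ tsupport f) (m : ℕ) (N : ℝ) :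
    4 * N * ∫ z, ‖f z‖ ^ 2 * carlemanWeight m N z ≤
      ∫ z, ‖fderiv ℝ f z 1 + I * fderiv ℝ f z I‖ ^ 2 * carlemanWeight m N z := by
  have hnhds : ∀ᶠ z in 𝓝 (0 : ℂ), f z = 0 := by
    filter_upwards [(isClosed_tsupport f).isOpen_compl.mem_nhds h0] with z hz
    exact image_eq_zero_of_notMem_tsupport hz
  let g : ℂ → ℂ := fun z ↦ (z ^ m)⁻¹ * f z
  have hg0 : g =ᶠ[𝓝 0] fun _ ↦ (0 : ℂ) := by
    filter_upwards [hnhds] with z hz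
    simp [g, hz]
  have hg : ContDiff ℝ 2 g := by
    rw [contDiff_iff_contDiffAt]
    intro z
    rcases eq_or_ne z 0 with rfl | hz
    · exact contDiffAt_const.congr_of_eventuallyEq hg0
    · exact ((contDiffAt_id.pow m).inv (pow_ne_zero m hz)).mul hf.contDiffAt
  have hgc : HasCompactSupport g := HasCompactSupport.intro hc.isCompact fun z hz ↦ by
    simp [g, image_eq_zero_of_notMem_tsupport hz]
  have hgd : ∀ z, fderiv ℝ g z 1 + I * fderiv ℝ g z I =
      (z ^ m)⁻¹ * (fderiv ℝ f z 1 + I * fderiv ℝ f z I) := fun z ↦ by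
    rcases eq_or_ne z 0 with rfl | hz
    · simp [hg0.fderiv_eq, fderiv_of_notMem_tsupport ℝ h0]
    · have h1 : HasDerivAt (fun z : ℂ ↦ (z ^ m)⁻¹) (deriv (fun z : ℂ ↦ (z ^ m)⁻¹) z) z :=
        DifferentiableAt.hasDerivAt ((differentiableAt_id.pow m).inv (pow_ne_zero m hz))
      have h2 := (hf.differentiable two_ne_zero z).hasFDerivAt
      have h3 := (h1.hasFDerivAt.restrictScalars ℝ).mul h2
      have h4 : ∀ v, fderiv ℝ g z v = _ := fun v ↦ DFunLike.congr_fun h3.fderiv v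
      rw [h4, h4]
      simp
      linear_combination f z * deriv (fun z : ℂ ↦ (z ^ m)⁻¹) z * I_mul_I
  refine Eq.trans_le (congrArg (4 * N * ·) (integral_congr_ae (.of_forall fun z ↦ ?_)))
    ((carleman_gaussian hg hgc N).trans_eq (integral_congr_ae (.of_forall fun z ↦ ?_)))
  · simp [g, carlemanWeight]
    ring
  · simp only
    rw [hgd]
    simp [carlemanWeight]
    ring

section Vector

variable {E : Type*} [NormedAddCommGroup E] [InnerProductSpace ℝ E] [FiniteDimensional ℝ E]

theorem exists_complexLinear_functionals (J₀ : E →L[ℝ] E) (hJ₀ : ∀ x, J₀ (J₀ x) = -x) :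
    ∃ L : Fin (Module.finrank ℝ E) → E →L[ℝ] ℂ, (∀ k x, L k (J₀ x) = I * L k x) ∧
      ∀ x, ∑ k, ‖L k x‖ ^ 2 = ‖x‖ ^ 2 + ‖J₀ x‖ ^ 2 := by
  set b := stdOrthonormalBasis ℝ E
  let L : Fin (Module.finrank ℝ E) → E →L[ℝ] ℂ := fun k ↦
    ofRealCLM.comp (innerSL ℝ (b k)) - (I • ofRealCLM).comp ((innerSL ℝ (b k)).comp J₀)
  have hLapp : ∀ k x, L k x = (inner ℝ (b k) x : ℝ) - I * (inner ℝ (b k) (J₀ x) : ℝ) := fun k x ↦ by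
    simp [L]
  refine ⟨L, fun k x ↦ ?_, fun x ↦ ?_⟩
  · rw [hLapp, hLapp, hJ₀, inner_neg_right]
    push_cast
    linear_combination (inner ℝ (b k) (J₀ x) : ℂ) * I_mul_I
  · rw [← b.sum_sq_norm_inner_right x, ← b.sum_sq_norm_inner_right (J₀ x), ← Finset.sum_add_distrib]
    refine Finset.sum_congr rfl fun k _ ↦ ?_
    rw [hLapp, Complex.sq_norm, normSq_apply]
    simp
    ring

theorem carleman_estimate (J₀ : E →L[ℝ] E) (hJ₀ : ∀ x, J₀ (J₀ x) = -x) {f : ℂ → E}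
    (hf : ContDiff ℝ 2 f) (hc : HasCompactSupport f) (h0 : (0 : ℂ) ∉ tsupport f)
    (m : ℕ) {N : ℝ} (hN : 0 ≤ N) :
    4 * N * ∫ z, ‖f z‖ ^ 2 * carlemanWeight m N z ≤
      (1 + ‖J₀‖ ^ 2) * ∫ z, ‖fderiv ℝ f z 1 + J₀ (fderiv ℝ f z I)‖ ^ 2 *
        carlemanWeight m N z := by
  obtain ⟨L, hLJ, hLsum⟩ := exists_complexLinear_functionals J₀ hJ₀
  set ρ := carlemanWeight m N
  set D : ℂ → E := fun z ↦ fderiv ℝ f z 1 + J₀ (fderiv ℝ f z I) with hD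
  have hDc : Continuous D := by
    have := hf.continuous_fderiv two_ne_zero
    fun_prop
  have hDs : ∀ z ∉ tsupport f, D z = 0 := fun z hz ↦ by
    simp [hD, fderiv_of_notMem_tsupport ℝ hz]
  have hfs : ∀ z ∉ tsupport f, f z = 0 := fun z hz ↦ image_eq_zero_of_notMem_tsupport hz
  have hfc := hf.continuous
  have hk : ∀ k, 4 * N * ∫ z, ‖L k (f z)‖ ^ 2 * ρ z ≤ ∫ z, ‖L k (D z)‖ ^ 2 * ρ z := fun k ↦ by
    have h1 : tsupport (fun z ↦ L k (f z)) ⊆ tsupport f :=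
      closure_mono fun z hz h ↦ hz (by simp [h])
    have h2 : ∀ z v, fderiv ℝ (fun z ↦ L k (f z)) z v = L k (fderiv ℝ f z v) := fun z v ↦
      DFunLike.congr_fun
        ((L k).hasFDerivAt.comp z (hf.differentiable two_ne_zero z).hasFDerivAt).fderiv v
    have := carleman_scalar ((L k).contDiff.comp hf) (hc.comp_left (g := L k) (map_zero _))
      (fun h ↦ h0 (h1 h)) m N
    refine this.trans_eq (integral_congr_ae (.of_forall fun z ↦ ?_))
    simp only [hD, Function.comp_def, h2, map_add, hLJ, ρ]
  have hi1 : ∀ k, Integrable fun z ↦ ‖L k (f z)‖ ^ 2 * ρ z := fun k ↦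
    integrable_mul_carlemanWeight (by fun_prop) hc.isCompact h0 (fun z hz ↦ by simp [hfs z hz]) m N
  have hi2 : ∀ k, Integrable fun z ↦ ‖L k (D z)‖ ^ 2 * ρ z := fun k ↦
    integrable_mul_carlemanWeight (by fun_prop) hc.isCompact h0 (fun z hz ↦ by simp [hDs z hz]) m N
  have hi3 : Integrable fun z ↦ ‖f z‖ ^ 2 * ρ z :=
    integrable_mul_carlemanWeight (by fun_prop) hc.isCompact h0 (fun z hz ↦ by simp [hfs z hz]) m N
  have hi4 : Integrable fun z ↦ ‖D z‖ ^ 2 * ρ z :=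
    integrable_mul_carlemanWeight (by fun_prop) hc.isCompact h0 (fun z hz ↦ by simp [hDs z hz]) m N
  have hsum := Finset.sum_le_sum fun k (_ : k ∈ Finset.univ) ↦ hk k
  rw [← Finset.mul_sum, ← integral_finsetSum _ fun k _ ↦ hi1 k,
    ← integral_finsetSum _ fun k _ ↦ hi2 k] at hsum
  have hi1' := integrable_finsetSum Finset.univ fun k _ ↦ hi1 k
  have hi2' := integrable_finsetSum Finset.univ fun k _ ↦ hi2 k
  simp only [← Finset.sum_mul, hLsum] at hsum hi1' hi2'
  calc 4 * N * ∫ z, ‖f z‖ ^ 2 * ρ z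
      ≤ 4 * N * ∫ z, (‖f z‖ ^ 2 + ‖J₀ (f z)‖ ^ 2) * ρ z := by
        refine mul_le_mul_of_nonneg_left (integral_mono hi3 hi1' fun z ↦ ?_) (by positivity)
        exact mul_le_mul_of_nonneg_right (le_add_of_nonneg_right (by positivity))
          (carlemanWeight_nonneg m N z)
    _ ≤ ∫ z, (‖D z‖ ^ 2 + ‖J₀ (D z)‖ ^ 2) * ρ z := hsum
    _ ≤ ∫ z, (1 + ‖J₀‖ ^ 2) * (‖D z‖ ^ 2 * ρ z) := by
        refine integral_mono hi2' (hi4.const_mul _) fun z ↦ ?_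
        simp only
        rw [← mul_assoc]
        refine mul_le_mul_of_nonneg_right ?_ (carlemanWeight_nonneg m N z)
        have := pow_le_pow_left₀ (norm_nonneg _) (J₀.le_opNorm (D z)) 2
        rw [mul_pow] at this
        linarith
    _ = (1 + ‖J₀‖ ^ 2) * ∫ z, ‖D z‖ ^ 2 * ρ z := integral_const_mul _ _


theorem carleman_cutoff (J₀ : E →L[ℝ] E) (hJ₀ : ∀ x, J₀ (J₀ x) = -x) (C : ℝ) :
    ∃ N, 0 ≤ N ∧ ∀ (m : ℕ) (ψ : ℂ → ℝ) (w : ℂ → E) (V : Set ℂ), IsOpen V → ContDiff ℝ 2 ψ →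
      HasCompactSupport ψ → (0 : ℂ) ∉ tsupport ψ → tsupport ψ ⊆ V → ContDiffOn ℝ 2 w V →
      (∀ z ∈ V, ‖fderiv ℝ w z 1 + J₀ (fderiv ℝ w z I)‖ ≤ C * ‖w z‖) →
      Integrable (fun z ↦ ‖ψ z • w z‖ ^ 2 * carlemanWeight m N z) ∧
      ∫ z, ‖ψ z • w z‖ ^ 2 * carlemanWeight m N z ≤
        ∫ z, (‖fderiv ℝ ψ z‖ ^ 2 * ‖w z‖ ^ 2) * carlemanWeight m N z := by
  set j := ‖J₀‖ with hj
  refine ⟨(1 + j ^ 2) * (C ^ 2 + (1 + j) ^ 2) / 2, by positivity, ?_⟩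
  intro m ψ w V hV hψ hψc h0 hψV hw hwJ
  set N := (1 + j ^ 2) * (C ^ 2 + (1 + j) ^ 2) / 2 with hNdef
  have hN : 0 ≤ N := by positivity
  set f : ℂ → E := fun z ↦ ψ z • w z with hf
  have hψ0 : ∀ z ∉ tsupport ψ, ∀ᶠ y in 𝓝 z, y ∉ tsupport ψ := fun z hz ↦
    (isClosed_tsupport ψ).isOpen_compl.mem_nhds hz
  have hf0 : ∀ z ∉ tsupport ψ, f z = 0 := fun z hz ↦ by
    simp [hf, image_eq_zero_of_notMem_tsupport hz]
  have hfs : tsupport f ⊆ tsupport ψ := closure_mono fun z hz h ↦ hz (by simp [hf, h])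
  have hfd : ContDiff ℝ 2 f := by
    rw [contDiff_iff_contDiffAt]
    intro z
    by_cases hz : z ∈ tsupport ψ
    · exact hψ.contDiffAt.smul (hw.contDiffAt (hV.mem_nhds (hψV hz)))
    · exact contDiffAt_const.congr_of_eventuallyEq ((hψ0 z hz).mono hf0)
  have hfc : HasCompactSupport f := HasCompactSupport.intro hψc.isCompact hf0
  have hest := carleman_estimate J₀ hJ₀ hfd hfc (fun h ↦ h0 (hfs h)) m hN
  set D : ℂ → E := fun z ↦ fderiv ℝ f z 1 + J₀ (fderiv ℝ f z I) with hD
  have hDc : Continuous D := by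
    have := hfd.continuous_fderiv two_ne_zero
    fun_prop
  have hDs : ∀ z ∉ tsupport ψ, D z = 0 := fun z hz ↦ by
    simp [hD, fderiv_of_notMem_tsupport ℝ (fun h ↦ hz (hfs h))]
  have hGc : Continuous fun z ↦ ‖fderiv ℝ ψ z‖ ^ 2 * ‖w z‖ ^ 2 := by
    rw [continuous_iff_continuousAt]
    intro z
    by_cases hz : z ∈ tsupport ψ
    · exact ((hψ.continuous_fderiv two_ne_zero).norm.pow 2).continuousAt.mul
        ((hw.contDiffAt (hV.mem_nhds (hψV hz))).continuousAt.norm.pow 2)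
    · refine (continuousAt_const (y := (0 : ℝ))).congr ((hψ0 z hz).mono fun y hy ↦ ?_)
      simp [fderiv_of_notMem_tsupport ℝ hy]
  have hi1 : Integrable fun z ↦ ‖f z‖ ^ 2 * carlemanWeight m N z :=
    integrable_mul_carlemanWeight (hfd.continuous.norm.pow 2) hψc.isCompact h0
      (fun z hz ↦ by simp [hf0 z hz]) m N
  have hi2 : Integrable fun z ↦ (‖fderiv ℝ ψ z‖ ^ 2 * ‖w z‖ ^ 2) * carlemanWeight m N z :=
    integrable_mul_carlemanWeight hGc hψc.isCompact h0
      (fun z hz ↦ by simp [fderiv_of_notMem_tsupport ℝ hz]) m N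
  have hi3 : Integrable fun z ↦ ‖D z‖ ^ 2 * carlemanWeight m N z :=
    integrable_mul_carlemanWeight (hDc.norm.pow 2) hψc.isCompact h0
      (fun z hz ↦ by simp [hDs z hz]) m N
  refine ⟨hi1, ?_⟩
  have hDle : ∀ z, ‖D z‖ ^ 2 ≤
      2 * C ^ 2 * ‖f z‖ ^ 2 + 2 * (1 + j) ^ 2 * (‖fderiv ℝ ψ z‖ ^ 2 * ‖w z‖ ^ 2) := by
    intro z
    by_cases hz : z ∈ tsupport ψ
    · have h1 := (hψ.differentiable two_ne_zero z).hasFDerivAt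
      have h2 := ((hw.contDiffAt (hV.mem_nhds (hψV hz))).differentiableAt two_ne_zero).hasFDerivAt
      have h3 : ∀ v, fderiv ℝ f z v = ψ z • fderiv ℝ w z v + fderiv ℝ ψ z v • w z := fun v ↦ by
        refine (DFunLike.congr_fun (h1.smul h2).fderiv v).trans ?_
        simp
      have h4 : D z = ψ z • (fderiv ℝ w z 1 + J₀ (fderiv ℝ w z I)) +
          (fderiv ℝ ψ z 1 • w z + fderiv ℝ ψ z I • J₀ (w z)) := by
        simp only [hD, h3, map_add, map_smul, smul_add]
        abel
      have h5 : ‖D z‖ ≤ C * ‖f z‖ + (1 + j) * (‖fderiv ℝ ψ z‖ * ‖w z‖) := by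
        have e1 : ‖ψ z • (fderiv ℝ w z 1 + J₀ (fderiv ℝ w z I))‖ ≤ C * ‖f z‖ := by
          rw [hf, norm_smul, norm_smul]
          nlinarith [mul_le_mul_of_nonneg_left (hwJ z (hψV hz)) (norm_nonneg (ψ z))]
        have e2 : ‖fderiv ℝ ψ z 1 • w z‖ ≤ ‖fderiv ℝ ψ z‖ * ‖w z‖ := by
          rw [norm_smul]
          gcongr
          simpa using (fderiv ℝ ψ z).le_opNorm 1
        have e3 : ‖fderiv ℝ ψ z I • J₀ (w z)‖ ≤ ‖fderiv ℝ ψ z‖ * (j * ‖w z‖) := by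
          rw [norm_smul]
          gcongr
          · simpa using (fderiv ℝ ψ z).le_opNorm I
          · exact J₀.le_opNorm _
        rw [h4]
        refine (norm_add_le _ _).trans ?_
        have := norm_add_le (fderiv ℝ ψ z 1 • w z) (fderiv ℝ ψ z I • J₀ (w z))
        linarith
      have h6 := pow_le_pow_left₀ (norm_nonneg _) h5 2
      nlinarith [sq_nonneg (C * ‖f z‖ - (1 + j) * (‖fderiv ℝ ψ z‖ * ‖w z‖))]
    · rw [hDs z hz, norm_zero, zero_pow two_ne_zero]
      positivity
  have hle : ∫ z, ‖D z‖ ^ 2 * carlemanWeight m N z ≤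
      2 * C ^ 2 * (∫ z, ‖f z‖ ^ 2 * carlemanWeight m N z) + 2 * (1 + j) ^ 2 *
        ∫ z, (‖fderiv ℝ ψ z‖ ^ 2 * ‖w z‖ ^ 2) * carlemanWeight m N z := by
    rw [← integral_const_mul, ← integral_const_mul, ← integral_add (hi1.const_mul _)
      (hi2.const_mul _)]
    refine integral_mono hi3 ((hi1.const_mul _).add (hi2.const_mul _)) fun z ↦ ?_
    have := mul_le_mul_of_nonneg_right (hDle z) (carlemanWeight_nonneg m N z)
    simp only
    linarith
  have h7 := hest.trans (mul_le_mul_of_nonneg_left hle (by positivity))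
  have h8 : 0 < 2 * (1 + j ^ 2) * (1 + j) ^ 2 := by
    have : 0 ≤ j := norm_nonneg _
    positivity
  refine le_of_mul_le_mul_left ?_ h8
  rw [hNdef] at h7 ⊢
  linarith

theorem exists_annular_cutoff : ∃ M : ℝ, 0 ≤ M ∧ ∀ r δ : ℝ, 0 < δ → 2 * δ < r → ∃ ψ : ℂ → ℝ,
    ContDiff ℝ 2 ψ ∧ tsupport ψ ⊆ closedBall 0 (2 * r) ∧ (0 : ℂ) ∉ tsupport ψ ∧
    (∀ z, 2 * δ ≤ ‖z‖ → ‖z‖ ≤ r → ψ z = 1) ∧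
    ∀ z, fderiv ℝ ψ z = 0 ∨ (r ≤ ‖z‖ ∧ ‖z‖ ≤ 2 * r ∧ ‖fderiv ℝ ψ z‖ ≤ M / r) ∨
      (δ ≤ ‖z‖ ∧ ‖z‖ ≤ 2 * δ ∧ ‖fderiv ℝ ψ z‖ ≤ M / δ) := by
  let χ : ContDiffBump (0 : ℂ) := ⟨1, 2, one_pos, one_lt_two⟩
  have hχ : ContDiff ℝ 2 χ := χ.contDiff
  obtain ⟨M, hM⟩ := (χ.hasCompactSupport.fderiv (𝕜 := ℝ)).exists_bound_of_continuous
    (hχ.continuous_fderiv two_ne_zero)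
  have hin : ∀ x : ℂ, ‖x‖ < 1 → fderiv ℝ χ x = 0 := fun x hx ↦ by
    have := χ.eventuallyEq_one_of_mem_ball (x := x) (by simpa [χ] using hx)
    rw [this.fderiv_eq]
    exact fderiv_const_apply (1 : ℝ)
  have hout : ∀ x : ℂ, 2 < ‖x‖ → fderiv ℝ χ x = 0 := fun x hx ↦
    fderiv_of_notMem_tsupport ℝ (by rw [χ.tsupport_eq]; simpa [χ] using hx)
  have h1 : ∀ x : ℂ, ‖x‖ ≤ 1 → χ x = 1 := fun x hx ↦
    χ.one_of_mem_closedBall (by simpa [χ] using hx)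
  have h2 : ∀ x : ℂ, 2 ≤ ‖x‖ → χ x = 0 := fun x hx ↦ χ.zero_of_le_dist (by simpa [χ] using hx)
  refine ⟨M, (norm_nonneg _).trans (hM 0), fun r δ hδ hδr ↦ ?_⟩
  have hr : 0 < r := by linarith
  have hn : ∀ {s : ℝ} (z : ℂ), 0 < s → ‖s⁻¹ • z‖ = ‖z‖ / s := fun z hs ↦ by
    rw [norm_smul, norm_inv, Real.norm_of_nonneg hs.le, inv_mul_eq_div]
  have hs : ∀ s : ℝ, ContDiff ℝ 2 fun z : ℂ ↦ χ (s⁻¹ • z) := fun s ↦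
    hχ.comp (contDiff_const_smul _)
  refine ⟨fun z ↦ χ (r⁻¹ • z) - χ (δ⁻¹ • z), (hs r).sub (hs δ), ?_, ?_, ?_, ?_⟩
  · refine closure_minimal (fun z hz ↦ ?_) isClosed_closedBall
    by_contra hz'
    rw [mem_closedBall_zero_iff, not_le] at hz'
    apply hz
    simp only
    rw [h2 _ (by rw [hn z hr, le_div_iff₀ hr]; exact hz'.le),
      h2 _ (by rw [hn z hδ, le_div_iff₀ hδ]; linarith), sub_zero]
  · rw [notMem_tsupport_iff_eventuallyEq]
    filter_upwards [ball_mem_nhds (0 : ℂ) hδ] with z hz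
    rw [mem_ball_zero_iff] at hz
    rw [h1 _ (by rw [hn z hr, div_le_iff₀ hr]; linarith),
      h1 _ (by rw [hn z hδ, div_le_iff₀ hδ]; linarith), sub_self]
    rfl
  · intro z hz1 hz2
    simp only
    rw [h1 _ (by rw [hn z hr, div_le_iff₀ hr]; linarith),
      h2 _ (by rw [hn z hδ, le_div_iff₀ hδ]; linarith), sub_zero]
  · intro z
    have hd : fderiv ℝ (fun z ↦ χ (r⁻¹ • z) - χ (δ⁻¹ • z)) z =
        r⁻¹ • fderiv ℝ χ (r⁻¹ • z) - δ⁻¹ • fderiv ℝ χ (δ⁻¹ • z) := by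
      rw [fderiv_fun_sub ((hs r).differentiable two_ne_zero z)
        ((hs δ).differentiable two_ne_zero z)]
      congr 1 <;> exact fderiv_comp_smul (f := (χ : ℂ → ℝ)) _
    have hb : ∀ {s : ℝ}, 0 < s → ‖s⁻¹ • fderiv ℝ χ (s⁻¹ • z)‖ ≤ M / s := fun {s} hs ↦ by
      rw [norm_smul, norm_inv, Real.norm_of_nonneg hs.le, div_eq_inv_mul]
      exact mul_le_mul_of_nonneg_left (hM _) (by positivity)
    have hin' : ∀ {s : ℝ}, 0 < s → ‖z‖ < s → fderiv ℝ χ (s⁻¹ • z) = 0 := fun {s} hs hz ↦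
      hin _ (by rw [hn z hs, div_lt_one hs]; exact hz)
    have hout' : ∀ {s : ℝ}, 0 < s → 2 * s < ‖z‖ → fderiv ℝ χ (s⁻¹ • z) = 0 := fun {s} hs hz ↦
      hout _ (by rw [hn z hs, lt_div_iff₀ hs]; exact hz)
    rw [hd]
    rcases lt_or_ge ‖z‖ r with hzr | hzr
    · rw [hin' hr hzr, smul_zero, zero_sub, norm_neg, neg_eq_zero]
      rcases lt_or_ge ‖z‖ δ with h | h
      · exact Or.inl (by rw [hin' hδ h, smul_zero])
      · rcases lt_or_ge (2 * δ) ‖z‖ with h' | h'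
        · exact Or.inl (by rw [hout' hδ h', smul_zero])
        · exact Or.inr (Or.inr ⟨h, h', hb hδ⟩)
    · rw [hout' hδ (by linarith), smul_zero, sub_zero]
      rcases lt_or_ge (2 * r) ‖z‖ with h' | h'
      · exact Or.inl (by rw [hout' hr h', smul_zero])
      · exact Or.inr (Or.inl ⟨hzr, h', hb hr⟩)

theorem eventually_eq_zero_of_flat (J₀ : E →L[ℝ] E) (hJ₀ : ∀ x, J₀ (J₀ x) = -x) {C : ℝ}
    {w : ℂ → E} {V : Set ℂ} (hV : IsOpen V) (h0V : (0 : ℂ) ∈ V) (hw : ContDiffOn ℝ 2 w V)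
    (hwJ : ∀ z ∈ V, ‖fderiv ℝ w z 1 + J₀ (fderiv ℝ w z I)‖ ≤ C * ‖w z‖)
    (hflat : ∀ m : ℕ, w =O[𝓝 0] fun z ↦ ‖z‖ ^ m) :
    ∀ᶠ z in 𝓝 (0 : ℂ), w z = 0 := by
  obtain ⟨N, hN, hcut⟩ := carleman_cutoff J₀ hJ₀ C
  obtain ⟨M, hM, hψ⟩ := exists_annular_cutoff
  obtain ⟨R, hR, hRV⟩ := Metric.isOpen_iff.1 hV 0 h0V
  set r := R / 4 with hr_def
  have hr : 0 < r := by positivity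
  have hrV : closedBall (0 : ℂ) (2 * r) ⊆ V :=
    (closedBall_subset_ball (by rw [hr_def]; linarith)).trans hRV
  obtain ⟨K, hK⟩ := (isCompact_closedBall (0 : ℂ) (2 * r)).exists_bound_of_continuousOn
    (hw.continuousOn.mono hrV)
  filter_upwards [ball_mem_nhds (0 : ℂ) hr] with z₁ hz₁
  rw [mem_ball_zero_iff] at hz₁
  by_contra hne
  have hw0 : w 0 = 0 := by
    obtain ⟨c, hc⟩ := (hflat 1).bound
    simpa using hc.self_of_nhds
  have hz₁0 : z₁ ≠ 0 := fun h ↦ hne (h ▸ hw0)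
  have hz₁p : 0 < ‖z₁‖ := norm_pos_iff.2 hz₁0
  set q := (‖z₁‖ + r) / 2 with hq
  set c := ‖w z₁‖ / 2 with hc_def
  have hc : 0 < c := half_pos (norm_pos_iff.2 hne)
  obtain ⟨ε, hε, hball⟩ : ∃ ε > 0, ∀ z ∈ ball z₁ ε, c ≤ ‖w z‖ ∧ ‖z‖ ≤ q ∧ ‖z₁‖ / 2 ≤ ‖z‖ := by
    have hcont : ContinuousAt w z₁ :=
      (hw.contDiffAt (hV.mem_nhds (hrV (by rw [mem_closedBall_zero_iff]; linarith)))).continuousAt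
    have e1 : ∀ᶠ z in 𝓝 z₁, c < ‖w z‖ :=
      hcont.norm.eventually_const_lt (half_lt_self (norm_pos_iff.2 hne))
    have e2 : ∀ᶠ z in 𝓝 z₁, ‖z‖ < q :=
      continuous_norm.continuousAt.eventually_lt_const (by rw [hq]; linarith)
    have e3 : ∀ᶠ z in 𝓝 z₁, ‖z₁‖ / 2 < ‖z‖ :=
      continuous_norm.continuousAt.eventually_const_lt (by linarith)
    obtain ⟨ε, hε, h⟩ := Metric.eventually_nhds_iff_ball.1 (e1.and (e2.and e3))
    exact ⟨ε, hε, fun z hz ↦ ⟨(h z hz).1.le, (h z hz).2.1.le, (h z hz).2.2.le⟩⟩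
  set a := volume.real (ball z₁ ε) with ha_def
  have ha : 0 < a :=
    ENNReal.toReal_pos (measure_ball_pos volume z₁ hε).ne' measure_ball_lt_top.ne
  set b := volume.real (closedBall (0 : ℂ) (2 * r)) with hb_def
  set G := Real.exp (N * (2 * r) ^ 2) with hG
  have hq0 : 0 < q := by positivity
  have main : ∀ m : ℕ, ∃ B, ∀ᶠ δ in 𝓝[>] (0 : ℝ), a * (c ^ 2 * (q ^ m)⁻¹ ^ 2) ≤
      b * ((M / r) ^ 2 * K ^ 2 * ((r ^ m)⁻¹ ^ 2 * G) + B * δ ^ 2) := by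
    intro m
    obtain ⟨L, hL0, hL⟩ := (hflat (m + 2)).exists_nonneg
    rw [Asymptotics.isBigOWith_iff] at hL
    obtain ⟨ρ, hρ, hLρ⟩ := Metric.eventually_nhds_iff_ball.1 hL
    refine ⟨M ^ 2 * (L * 2 ^ (m + 2)) ^ 2 * G, ?_⟩
    have hpos : (0 : ℝ) < min (ρ / 2) (min (r / 2) (‖z₁‖ / 4)) := by positivity
    filter_upwards [Ioo_mem_nhdsGT hpos] with δ hδ
    obtain ⟨hδ0, hδ'⟩ := hδ
    rw [lt_min_iff, lt_min_iff] at hδ'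
    obtain ⟨hδρ, hδr, hδz⟩ := hδ'
    obtain ⟨ψ, hψs, hψt, hψ0, hψ1, hψd⟩ := hψ r δ hδ0 (by linarith)
    have hψc : HasCompactSupport ψ :=
      HasCompactSupport.of_support_subset_isCompact (isCompact_closedBall 0 (2 * r))
        ((subset_tsupport ψ).trans hψt)
    obtain ⟨hint, hle⟩ := hcut m ψ w V hV hψs hψc hψ0 (hψt.trans hrV) hw hwJ
    have lower : a * (c ^ 2 * (q ^ m)⁻¹ ^ 2) ≤
        ∫ z, ‖ψ z • w z‖ ^ 2 * carlemanWeight m N z := by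
      rw [← smul_eq_mul, ← integral_indicator_const _ measurableSet_ball]
      refine integral_mono ((integrable_indicator_iff measurableSet_ball).2
        (integrableOn_const measure_ball_lt_top.ne)) hint fun z ↦ ?_
      by_cases hz : z ∈ ball z₁ ε
      · obtain ⟨h1, h2, h3⟩ := hball z hz
        have hz0 : 0 < ‖z‖ := by linarith
        simp only [indicator_of_mem hz]
        rw [hψ1 z (by linarith) (h2.trans (by rw [hq]; linarith)), one_smul, carlemanWeight]
        have : 1 ≤ Real.exp (N * ‖z‖ ^ 2) := Real.one_le_exp (by positivity)
        calc c ^ 2 * (q ^ m)⁻¹ ^ 2 ≤ ‖w z‖ ^ 2 * ((‖z‖ ^ m)⁻¹ ^ 2 * 1) := by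
              rw [mul_one]; gcongr
          _ ≤ _ := by gcongr
      · simp only [indicator_of_notMem hz]
        exact mul_nonneg (sq_nonneg _) (carlemanWeight_nonneg m N z)
    have upper : ∫ z, (‖fderiv ℝ ψ z‖ ^ 2 * ‖w z‖ ^ 2) * carlemanWeight m N z ≤
        b * ((M / r) ^ 2 * K ^ 2 * ((r ^ m)⁻¹ ^ 2 * G) +
          M ^ 2 * (L * 2 ^ (m + 2)) ^ 2 * G * δ ^ 2) := by
      rw [← smul_eq_mul, ← integral_indicator_const _ measurableSet_closedBall]
      refine integral_mono_of_nonneg (.of_forall fun z ↦ mul_nonneg (by positivity)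
        (carlemanWeight_nonneg m N z)) ((integrable_indicator_iff measurableSet_closedBall).2
        (integrableOn_const measure_closedBall_lt_top.ne)) (.of_forall fun z ↦ ?_)
      simp only
      rcases hψd z with h | ⟨h1, h2, h3⟩ | ⟨h1, h2, h3⟩
      · rw [h, norm_zero, zero_pow two_ne_zero, zero_mul, zero_mul]
        exact indicator_nonneg (fun _ _ ↦ by positivity) z
      · have hz : z ∈ closedBall (0 : ℂ) (2 * r) := mem_closedBall_zero_iff.2 h2
        rw [indicator_of_mem hz, carlemanWeight]
        have := hK z hz
        calc _ ≤ (M / r) ^ 2 * K ^ 2 * ((r ^ m)⁻¹ ^ 2 * G) := by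
              rw [hG]; gcongr
          _ ≤ _ := le_add_of_nonneg_right (by positivity)
      · have hz : z ∈ closedBall (0 : ℂ) (2 * r) := mem_closedBall_zero_iff.2 (by linarith)
        rw [indicator_of_mem hz, carlemanWeight]
        have := hLρ z (mem_ball_zero_iff.2 (by linarith))
        rw [norm_pow, norm_norm] at this
        have h4 : ‖w z‖ ≤ L * (2 * δ) ^ (m + 2) := this.trans (by gcongr)
        calc _ ≤ (M / δ) ^ 2 * (L * (2 * δ) ^ (m + 2)) ^ 2 * ((δ ^ m)⁻¹ ^ 2 * G) := by
              rw [hG]; gcongr; linarith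
          _ = M ^ 2 * (L * 2 ^ (m + 2)) ^ 2 * G * δ ^ 2 := by
              have : δ ≠ 0 := hδ0.ne'
              rw [mul_pow 2 δ, pow_add δ]
              field_simp
          _ ≤ _ := le_add_of_nonneg_left (by positivity)
    exact lower.trans (hle.trans upper)
  have main' : ∀ m : ℕ, a * c ^ 2 ≤ b * ((M / r) ^ 2 * K ^ 2 * G) * ((q / r) ^ 2) ^ m := by
    intro m
    obtain ⟨B, hB⟩ := main m
    have hlim : Tendsto (fun δ : ℝ ↦ b * ((M / r) ^ 2 * K ^ 2 * ((r ^ m)⁻¹ ^ 2 * G) + B * δ ^ 2))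
        (𝓝[>] 0) (𝓝 (b * ((M / r) ^ 2 * K ^ 2 * ((r ^ m)⁻¹ ^ 2 * G) + B * 0 ^ 2))) := by
      refine Tendsto.mono_left ?_ nhdsWithin_le_nhds
      exact Continuous.tendsto (by fun_prop) 0
    have h := ge_of_tendsto hlim hB
    have h2 := mul_le_mul_of_nonneg_right h (by positivity : 0 ≤ (q ^ m) ^ 2)
    have hqm : (q ^ m) ≠ 0 := by positivity
    have hrm : (r ^ m) ≠ 0 := by positivity
    calc a * c ^ 2 = a * (c ^ 2 * (q ^ m)⁻¹ ^ 2) * (q ^ m) ^ 2 := by field_simp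
      _ ≤ _ := h2
      _ = _ := by
        have : ((q / r) ^ 2) ^ m = (q ^ m) ^ 2 / (r ^ m) ^ 2 := by
          rw [← pow_mul, mul_comm 2 m, pow_mul, div_pow, div_pow]
        rw [this]
        field_simp
        ring
  have hqr : (q / r) ^ 2 < 1 := by
    have : q / r < 1 := by rw [div_lt_one hr, hq]; linarith
    exact pow_lt_one₀ (by positivity) this two_ne_zero
  have hlim := (tendsto_pow_atTop_nhds_zero_of_lt_one (by positivity) hqr).const_mul
    (b * ((M / r) ^ 2 * K ^ 2 * G))
  rw [mul_zero] at hlim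
  have := ge_of_tendsto' hlim main'
  have : 0 < a * c ^ 2 := by positivity
  linarith

end Vector

section Order

variable {F : Type*} [NormedAddCommGroup F] [NormedSpace ℝ F]

theorem contDiffOn_fderiv_apply {f : ℂ → F} {V : Set ℂ} (hV : IsOpen V)
    (hf : ContDiffOn ℝ (⊤ : ℕ∞) f V) (e : ℂ) :
    ContDiffOn ℝ (⊤ : ℕ∞) (fun z ↦ fderiv ℝ f z e) V :=
  (hf.fderiv_of_isOpen hV (by simp)).clm_apply contDiffOn_const

theorem hasFDerivAt_of_contDiffOn {f : ℂ → F} {V : Set ℂ} (hV : IsOpen V)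
    (hf : ContDiffOn ℝ (⊤ : ℕ∞) f V) {z : ℂ} (hz : z ∈ V) :
    HasFDerivAt f (fderiv ℝ f z) z :=
  ((hf.contDiffAt (hV.mem_nhds hz)).differentiableAt (by simp)).hasFDerivAt

theorem fderiv_fderiv_apply_comm {f : ℂ → F} {V : Set ℂ} (hV : IsOpen V)
    (hf : ContDiffOn ℝ (⊤ : ℕ∞) f V) {z : ℂ} (hz : z ∈ V) (e e' : ℂ) :
    fderiv ℝ (fun z ↦ fderiv ℝ f z e) z e' = fderiv ℝ (fun z ↦ fderiv ℝ f z e') z e := by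
  have hd := hasFDerivAt_of_contDiffOn hV (hf.fderiv_of_isOpen hV (m := (⊤ : ℕ∞)) (by simp)) hz
  have key : ∀ e e', fderiv ℝ (fun z ↦ fderiv ℝ f z e) z e' = fderiv ℝ (fderiv ℝ f) z e' e := by
    intro e e'
    rw [(hd.clm_apply (hasFDerivAt_const e z)).fderiv]
    simp
  rw [key, key]
  exact (hf.contDiffAt (hV.mem_nhds hz)).isSymmSndFDerivAt
    (by simpa using WithTop.coe_le_coe.2 (le_top : (2 : ℕ∞) ≤ ⊤)) e' e

theorem isBigO_pow_succ_of_fderiv {f : ℂ → F} {m : ℕ}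
    (hf : ∀ᶠ z in 𝓝 (0 : ℂ), DifferentiableAt ℝ f z) (h0 : f 0 = 0)
    (h1 : (fun z ↦ fderiv ℝ f z 1) =O[𝓝 0] fun z ↦ ‖z‖ ^ m)
    (hI : (fun z ↦ fderiv ℝ f z I) =O[𝓝 0] fun z ↦ ‖z‖ ^ m) :
    f =O[𝓝 0] fun z ↦ ‖z‖ ^ (m + 1) := by
  obtain ⟨c, hc⟩ := h1.bound
  obtain ⟨c', hc'⟩ := hI.bound
  obtain ⟨r, hr, H⟩ := Metric.eventually_nhds_iff_ball.1 (hf.and (hc.and hc'))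
  have hD : ∀ z ∈ ball (0 : ℂ) r, ‖fderiv ℝ f z‖ ≤ (|c| + |c'|) * ‖z‖ ^ m := by
    intro z hz
    obtain ⟨-, h1, h2⟩ := H z hz
    rw [norm_pow, norm_norm] at h1 h2
    refine ContinuousLinearMap.opNorm_le_bound _ (by positivity) fun w ↦ ?_
    have hw : fderiv ℝ f z w = w.re • fderiv ℝ f z 1 + w.im • fderiv ℝ f z I := by
      rw [← map_smul, ← map_smul, ← map_add]
      congr 1
      apply Complex.ext <;> simp
    have h1' : ‖fderiv ℝ f z 1‖ ≤ |c| * ‖z‖ ^ m := h1.trans (by gcongr; exact le_abs_self c)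
    have h2' : ‖fderiv ℝ f z I‖ ≤ |c'| * ‖z‖ ^ m := h2.trans (by gcongr; exact le_abs_self c')
    calc ‖fderiv ℝ f z w‖ ≤ |w.re| * ‖fderiv ℝ f z 1‖ + |w.im| * ‖fderiv ℝ f z I‖ := by
          rw [hw]
          refine (norm_add_le _ _).trans_eq ?_
          rw [norm_smul, norm_smul, Real.norm_eq_abs, Real.norm_eq_abs]
      _ ≤ ‖w‖ * (|c| * ‖z‖ ^ m) + ‖w‖ * (|c'| * ‖z‖ ^ m) := by
          gcongr
          · exact abs_re_le_norm w
          · exact abs_im_le_norm w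
      _ = (|c| + |c'|) * ‖z‖ ^ m * ‖w‖ := by ring
  refine Asymptotics.IsBigO.of_bound (|c| + |c'|) ?_
  filter_upwards [ball_mem_nhds (0 : ℂ) hr] with z hz
  have hsub : closedBall (0 : ℂ) ‖z‖ ⊆ ball 0 r := closedBall_subset_ball (by simpa using hz)
  have := (convex_closedBall (0 : ℂ) ‖z‖).norm_image_sub_le_of_norm_fderiv_le (𝕜 := ℝ) (f := f)
    (C := (|c| + |c'|) * ‖z‖ ^ m) (fun w hw ↦ (H w (hsub hw)).1)
    (fun w hw ↦ (hD w (hsub hw)).trans (by gcongr; simpa using hw))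
    (mem_closedBall_self (norm_nonneg z)) (show z ∈ closedBall (0 : ℂ) ‖z‖ by simp)
  rw [norm_pow, norm_norm]
  simpa [h0, pow_succ, mul_assoc] using this

theorem isBigO_clm_apply {A : ℂ → F →L[ℝ] F} {f : ℂ → F} {g h : ℂ → ℝ}
    (hA : A =O[𝓝 0] g) (hf : f =O[𝓝 0] h) :
    (fun z ↦ A z (f z)) =O[𝓝 0] fun z ↦ g z * h z :=
  (Asymptotics.IsBigO.of_norm_le (g := fun z ↦ ‖A z‖ * ‖f z‖)
    fun z ↦ (A z).le_opNorm (f z)).trans (hA.norm_left.mul hf.norm_left)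

theorem isBigO_continuous_clm_apply {A : ℂ → F →L[ℝ] F} {f : ℂ → F} {h : ℂ → ℝ}
    (hA : ContinuousAt A 0) (hf : f =O[𝓝 0] h) :
    (fun z ↦ A z (f z)) =O[𝓝 0] h := by
  simpa using isBigO_clm_apply (hA.tendsto.isBigO_one ℝ) hf

theorem fderiv_eq_zero_of_apply_one_eq_zero {J : F → F →L[ℝ] F} {u : ℂ → F} {z : ℂ}
    (hz : fderiv ℝ u z I = J (u z) (fderiv ℝ u z 1)) (h1 : fderiv ℝ u z 1 = 0) :
    fderiv ℝ u z = 0 := by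
  ext w
  rw [show w = w.re • (1 : ℂ) + w.im • I by apply Complex.ext <;> simp, map_add, map_smul,
    map_smul, hz, h1]
  simp

/-- The iterated partial derivatives of `v` in the direction `1`. -/
noncomputable def iteratedPartial (v : ℂ → F) : ℕ → ℂ → F
  | 0 => v
  | j + 1 => fun z ↦ fderiv ℝ (iteratedPartial v j) z 1

theorem contDiffOn_iteratedPartial {v : ℂ → F} {V : Set ℂ} (hV : IsOpen V)
    (hv : ContDiffOn ℝ (⊤ : ℕ∞) v V) (j : ℕ) :
    ContDiffOn ℝ (⊤ : ℕ∞) (iteratedPartial v j) V := by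
  induction j with
  | zero => exact hv
  | succ j ih => exact contDiffOn_fderiv_apply hV ih 1

theorem exists_fderiv_iteratedPartial_eq {J B : ℂ → F →L[ℝ] F} {v : ℂ → F} {V : Set ℂ}
    (hV : IsOpen V) (hJ : ContDiffOn ℝ (⊤ : ℕ∞) J V) (hB : ContDiffOn ℝ (⊤ : ℕ∞) B V)
    (hv : ContDiffOn ℝ (⊤ : ℕ∞) v V)
    (h : ∀ z ∈ V, fderiv ℝ v z I = J z (fderiv ℝ v z 1) + B z (v z)) (j : ℕ) :
    ∃ A : ℕ → ℂ → F →L[ℝ] F, (∀ i, ContDiffOn ℝ (⊤ : ℕ∞) (A i) V) ∧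
      ∀ z ∈ V, fderiv ℝ (iteratedPartial v j) z I = J z (iteratedPartial v (j + 1) z) +
        ∑ i ∈ Finset.range (j + 1), A i z (iteratedPartial v i z) := by
  induction j with
  | zero => exact ⟨fun _ ↦ B, fun _ ↦ hB, fun z hz ↦ by simpa [iteratedPartial] using h z hz⟩
  | succ j ih =>
    obtain ⟨A, hA, hAeq⟩ := ih
    have hvj := contDiffOn_iteratedPartial hV hv
    refine ⟨fun i ↦ match i with
      | 0 => fun z ↦ fderiv ℝ (A 0) z 1
      | i + 1 => fun z ↦ (if i < j then fderiv ℝ (A (i + 1)) z 1 else fderiv ℝ J z 1) + A i z,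
      fun i ↦ ?_, fun z hz ↦ ?_⟩
    · cases i with
      | zero => exact contDiffOn_fderiv_apply hV (hA 0) 1
      | succ i =>
        refine ContDiffOn.add ?_ (hA i)
        split_ifs
        · exact contDiffOn_fderiv_apply hV (hA (i + 1)) 1
        · exact contDiffOn_fderiv_apply hV hJ 1
    · have hd : ∀ {C : ℂ → F →L[ℝ] F}, ContDiffOn ℝ (⊤ : ℕ∞) C V → ∀ i,
          HasFDerivAt (fun z ↦ C z (iteratedPartial v i z)) _ z := fun hC i ↦
        (hasFDerivAt_of_contDiffOn hV hC hz).clm_apply (hasFDerivAt_of_contDiffOn hV (hvj i) hz)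
      have hsum := (hd hJ (j + 1)).add
        (HasFDerivAt.fun_sum fun i (_ : i ∈ Finset.range (j + 1)) ↦ hd (hA i) i)
      have heq : (fun z ↦ fderiv ℝ (iteratedPartial v j) z I) =ᶠ[𝓝 z] _ :=
        eventually_of_mem (hV.mem_nhds hz) hAeq
      have hstep : fderiv ℝ (iteratedPartial v (j + 1)) z I =
          fderiv ℝ (fun z ↦ fderiv ℝ (iteratedPartial v j) z I) z 1 :=
        fderiv_fderiv_apply_comm hV (hvj j) hz 1 I
      rw [hstep, (hsum.congr_of_eventuallyEq heq).fderiv]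
      have hp : ∀ i, fderiv ℝ (iteratedPartial v i) z 1 = iteratedPartial v (i + 1) z :=
        fun i ↦ rfl
      simp only [_root_.add_apply, _root_.sum_apply, ContinuousLinearMap.comp_apply,
        ContinuousLinearMap.flip_apply, hp]
      have hlt : ∑ i ∈ Finset.range j, (if i < j then fderiv ℝ (A (i + 1)) z 1
          else fderiv ℝ J z 1) (iteratedPartial v (i + 1) z) =
          ∑ i ∈ Finset.range j, fderiv ℝ (A (i + 1)) z 1 (iteratedPartial v (i + 1) z) :=
        Finset.sum_congr rfl fun i hi ↦ by rw [if_pos (Finset.mem_range.1 hi)]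
      rw [Finset.sum_add_distrib,
        Finset.sum_range_succ' (fun i ↦ fderiv ℝ (A i) z 1 (iteratedPartial v i z)),
        Finset.sum_range_succ' _ (j + 1)]
      simp only [_root_.add_apply, Finset.sum_add_distrib]
      rw [Finset.sum_range_succ (fun i ↦ (if i < j then fderiv ℝ (A (i + 1)) z 1
        else fderiv ℝ J z 1) (iteratedPartial v (i + 1) z)), if_neg (lt_irrefl j), hlt]
      abel

theorem iteratedPartial_isBigO {J B : ℂ → F →L[ℝ] F} {v : ℂ → F} {V : Set ℂ}
    (hV : IsOpen V) (h0V : (0 : ℂ) ∈ V) (hJ : ContDiffOn ℝ (⊤ : ℕ∞) J V)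
    (hB : ContDiffOn ℝ (⊤ : ℕ∞) B V) (hv : ContDiffOn ℝ (⊤ : ℕ∞) v V)
    (h : ∀ z ∈ V, fderiv ℝ v z I = J z (fderiv ℝ v z 1) + B z (v z)) {k : ℕ}
    (hk : ∀ i < k, iteratedPartial v i 0 = 0) {m j : ℕ} (hjm : j + m ≤ k) :
    iteratedPartial v j =O[𝓝 0] fun z ↦ ‖z‖ ^ m := by
  have hV0 := hV.mem_nhds h0V
  induction m generalizing j with
  | zero =>
    have hc := ((contDiffOn_iteratedPartial hV hv j).contDiffAt hV0).continuousAt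
    simpa using hc.tendsto.isBigO_one ℝ
  | succ m ih =>
    refine isBigO_pow_succ_of_fderiv ?_ (hk j (by omega)) (ih (j := j + 1) (by omega)) ?_
    · filter_upwards [hV0] with z hz
      exact (hasFDerivAt_of_contDiffOn hV (contDiffOn_iteratedPartial hV hv j) hz).differentiableAt
    · obtain ⟨A, hA, hAeq⟩ := exists_fderiv_iteratedPartial_eq hV hJ hB hv h j
      refine Asymptotics.IsBigO.congr' ?_
        (eventually_of_mem hV0 fun z hz ↦ (hAeq z hz).symm) EventuallyEq.rfl
      refine (isBigO_continuous_clm_apply (hJ.contDiffAt hV0).continuousAt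
        (ih (j := j + 1) (by omega))).add (Asymptotics.IsBigO.fun_sum fun i hi ↦ ?_)
      have := Finset.mem_range.1 hi
      exact isBigO_continuous_clm_apply ((hA i).contDiffAt hV0).continuousAt (ih (by omega))

/-- The map `c ↦ c • a`, where `ℂ` acts through the complex structure `J₀`. -/
noncomputable def complexSmulCLM (J₀ : F →L[ℝ] F) (a : F) : ℂ →L[ℝ] F :=
  reCLM.smulRight a + imCLM.smulRight (J₀ a)

theorem complexSmulCLM_apply (J₀ : F →L[ℝ] F) (a : F) (c : ℂ) :
    complexSmulCLM J₀ a c = c.re • a + c.im • J₀ a := rfl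

theorem complexSmulCLM_mul_I {J₀ : F →L[ℝ] F} (hJ₀ : ∀ x, J₀ (J₀ x) = -x) (a : F) (c : ℂ) :
    complexSmulCLM J₀ a (c * I) = J₀ (complexSmulCLM J₀ a c) := by
  simp [complexSmulCLM_apply, hJ₀, add_comm]

theorem exists_le_norm_complexSmulCLM {J₀ : F →L[ℝ] F} (hJ₀ : ∀ x, J₀ (J₀ x) = -x) {a : F}
    (ha : a ≠ 0) : ∃ δ > 0, ∀ c, δ * ‖c‖ ≤ ‖complexSmulCLM J₀ a c‖ := by
  have hker : (complexSmulCLM J₀ a : ℂ →ₗ[ℝ] F).ker = ⊥ := by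
    refine LinearMap.ker_eq_bot'.2 fun c hc ↦ ?_
    rw [ContinuousLinearMap.coe_coe, complexSmulCLM_apply] at hc
    have h1 : normSq c • a = c.re • (c.re • a + c.im • J₀ a) -
        c.im • J₀ (c.re • a + c.im • J₀ a) := by
      simp only [map_add, map_smul, hJ₀, normSq_apply]
      module
    rw [hc] at h1
    simpa [ha] using h1
  obtain ⟨K, hK, hanti⟩ := LinearMap.exists_antilipschitzWith _ hker
  refine ⟨(K : ℝ)⁻¹, by positivity, fun c ↦ ?_⟩
  have := hanti.le_mul_norm_sub c 0
  rw [inv_mul_le_iff₀ (by positivity)]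
  simpa using this

theorem iteratedPartial_sub_isBigO {J B : ℂ → F →L[ℝ] F} {v : ℂ → F} {V : Set ℂ}
    (hV : IsOpen V) (h0V : (0 : ℂ) ∈ V) (hJ : ContDiffOn ℝ (⊤ : ℕ∞) J V)
    (hJ₀ : ∀ x, J 0 (J 0 x) = -x)
    (hB : ContDiffOn ℝ (⊤ : ℕ∞) B V) (hv : ContDiffOn ℝ (⊤ : ℕ∞) v V)
    (h : ∀ z ∈ V, fderiv ℝ v z I = J z (fderiv ℝ v z 1) + B z (v z)) {k : ℕ}
    (hk : ∀ i < k, iteratedPartial v i 0 = 0) {p j : ℕ} (hjp : j + p = k) :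
    (fun z ↦ iteratedPartial v j z -
      complexSmulCLM (J 0) (iteratedPartial v k 0) (z ^ p / (p.factorial : ℂ))) =O[𝓝 0]
        fun z ↦ ‖z‖ ^ (p + 1) := by
  have hV0 := hV.mem_nhds h0V
  have hvj := contDiffOn_iteratedPartial hV hv
  induction p generalizing j with
  | zero =>
    obtain rfl : j = k := by omega
    have := (hasFDerivAt_of_contDiffOn hV (hvj j) h0V).isBigO_sub
    simpa [complexSmulCLM_apply] using this.norm_right
  | succ p ih =>
    set L := complexSmulCLM (J 0) (iteratedPartial v k 0) with hL
    have hmon : ∀ z, HasFDerivAt (fun z ↦ L (z ^ (p + 1) / ((p + 1).factorial : ℂ)))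
        (L ∘L (ContinuousLinearMap.toSpanSingleton ℂ
          (z ^ p / (p.factorial : ℂ))).restrictScalars ℝ) z := by
      intro z
      have h1 : HasDerivAt (fun z : ℂ ↦ z ^ (p + 1) / ((p + 1).factorial : ℂ))
          (z ^ p / (p.factorial : ℂ)) z := by
        refine ((hasDerivAt_pow (p + 1) z).div_const _).congr_deriv ?_
        rw [Nat.factorial_succ]
        have : (p.factorial : ℂ) ≠ 0 := by exact_mod_cast p.factorial_ne_zero
        have : (p : ℂ) + 1 ≠ 0 := by exact_mod_cast p.succ_ne_zero
        push_cast
        field_simp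
      exact L.hasFDerivAt.comp z (h1.hasFDerivAt.restrictScalars ℝ)
    have hder : ∀ z ∈ V, ∀ e, fderiv ℝ (fun z ↦ iteratedPartial v j z -
        L (z ^ (p + 1) / ((p + 1).factorial : ℂ))) z e =
          fderiv ℝ (iteratedPartial v j) z e - L (z ^ p / (p.factorial : ℂ) * e) := by
      intro z hz e
      rw [((hasFDerivAt_of_contDiffOn hV (hvj j) hz).fun_sub (hmon z)).fderiv]
      simp [mul_comm]
    have hih := ih (j := j + 1) (by omega)
    refine isBigO_pow_succ_of_fderiv ?_ ?_ ?_ ?_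
    · filter_upwards [hV0] with z hz
      exact ((hasFDerivAt_of_contDiffOn hV (hvj j) hz).fun_sub (hmon z)).differentiableAt
    · simp [hk j (by omega)]
    · refine hih.congr' (eventually_of_mem hV0 fun z hz ↦ ?_) EventuallyEq.rfl
      simp [hder z hz, iteratedPartial]
    · obtain ⟨A, hA, hAeq⟩ := exists_fderiv_iteratedPartial_eq hV hJ hB hv h j
      have hJd : (fun z ↦ J z - J 0) =O[𝓝 0] fun z ↦ ‖z‖ := by
        simpa using (hasFDerivAt_of_contDiffOn hV hJ h0V).isBigO_sub.norm_right
      have h1 : (fun z ↦ (J z - J 0) (iteratedPartial v (j + 1) z)) =O[𝓝 0]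
          fun z ↦ ‖z‖ ^ (p + 1) := by
        simpa [pow_succ'] using isBigO_clm_apply hJd
          (iteratedPartial_isBigO hV h0V hJ hB hv h hk (m := p) (j := j + 1) (by omega))
      have h2 : (fun z ↦ ∑ i ∈ Finset.range (j + 1), A i z (iteratedPartial v i z)) =O[𝓝 0]
          fun z ↦ ‖z‖ ^ (p + 1) := by
        refine Asymptotics.IsBigO.fun_sum fun i hi ↦ ?_
        have := Finset.mem_range.1 hi
        exact isBigO_continuous_clm_apply ((hA i).contDiffAt hV0).continuousAt
          (iteratedPartial_isBigO hV h0V hJ hB hv h hk (by omega))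
      have h3 := isBigO_continuous_clm_apply (A := fun _ ↦ J 0) continuousAt_const hih
      refine ((h3.add h1).add h2).congr' (eventually_of_mem hV0 fun z hz ↦ ?_) EventuallyEq.rfl
      beta_reduce
      rw [hder z hz, hAeq z hz, complexSmulCLM_mul_I hJ₀]
      simp only [map_sub, _root_.sub_apply]
      abel

theorem eventually_ne_zero_or_flat {J B : ℂ → F →L[ℝ] F} {v : ℂ → F} {V : Set ℂ}
    (hV : IsOpen V) (h0V : (0 : ℂ) ∈ V) (hJ : ContDiffOn ℝ (⊤ : ℕ∞) J V)
    (hJ₀ : ∀ x, J 0 (J 0 x) = -x)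
    (hB : ContDiffOn ℝ (⊤ : ℕ∞) B V) (hv : ContDiffOn ℝ (⊤ : ℕ∞) v V)
    (h : ∀ z ∈ V, fderiv ℝ v z I = J z (fderiv ℝ v z 1) + B z (v z)) :
    (∀ᶠ z in 𝓝[≠] (0 : ℂ), v z ≠ 0) ∨ ∀ m : ℕ, v =O[𝓝 0] fun z ↦ ‖z‖ ^ m := by
  classical
  by_cases hex : ∃ k, iteratedPartial v k 0 ≠ 0
  · left
    have hk : ∀ i < Nat.find hex, iteratedPartial v i 0 = 0 := fun i hi ↦
      not_not.1 (Nat.find_min hex hi)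
    set k := Nat.find hex
    obtain ⟨δ, hδ, hδle⟩ := exists_le_norm_complexSmulCLM hJ₀ (Nat.find_spec hex)
    obtain ⟨C, hC, hbound⟩ := (iteratedPartial_sub_isBigO hV h0V hJ hJ₀ hB hv h hk
      (p := k) (j := 0) (by omega)).exists_pos
    have hf : (0 : ℝ) < k.factorial := by exact_mod_cast k.factorial_pos
    have hr : 0 < δ / (C * k.factorial) := by positivity
    filter_upwards [nhdsWithin_le_nhds hbound.bound, nhdsWithin_le_nhds (ball_mem_nhds _ hr),
      self_mem_nhdsWithin] with z hz hzr hz0 hvz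
    rw [mem_ball_zero_iff, lt_div_iff₀ (by positivity)] at hzr
    have hzpos : 0 < ‖z‖ := norm_pos_iff.2 hz0
    have h1 := hδle (z ^ k / (k.factorial : ℂ))
    have h2 : ‖complexSmulCLM (J 0) (iteratedPartial v k 0) (z ^ k / (k.factorial : ℂ))‖ ≤
        C * ‖z‖ ^ (k + 1) := by
      simpa [iteratedPartial, hvz] using hz
    have h3 : δ * (‖z‖ ^ k / k.factorial) ≤ C * ‖z‖ ^ (k + 1) := by
      simpa using h1.trans h2
    rw [mul_div_assoc', div_le_iff₀ hf, pow_succ] at h3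
    have hzk : 0 < ‖z‖ ^ k := by positivity
    have := mul_lt_mul_of_pos_left hzr hzk
    nlinarith
  · push Not at hex
    exact .inr fun m ↦ iteratedPartial_isBigO hV h0V hJ hB hv h (k := m) (fun i _ ↦ hex i)
      (j := 0) (by omega)

end Order

section UniqueContinuation

variable {E : Type*} [NormedAddCommGroup E] [InnerProductSpace ℝ E] [FiniteDimensional ℝ E]

theorem eventually_eq_zero_of_flat_of_eq {J B : ℂ → E →L[ℝ] E} {v : ℂ → E} {V : Set ℂ}
    (hV : IsOpen V) (h0V : (0 : ℂ) ∈ V) (hJ : ContDiffOn ℝ (⊤ : ℕ∞) J V)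
    (hJsq : ∀ z ∈ V, ∀ x, J z (J z x) = -x)
    (hB : ContDiffOn ℝ (⊤ : ℕ∞) B V) (hv : ContDiffOn ℝ (⊤ : ℕ∞) v V)
    (h : ∀ z ∈ V, fderiv ℝ v z I = J z (fderiv ℝ v z 1) + B z (v z))
    (hflat : ∀ m : ℕ, v =O[𝓝 0] fun z ↦ ‖z‖ ^ m) :
    ∀ᶠ z in 𝓝 (0 : ℂ), v z = 0 := by
  have hV0 := hV.mem_nhds h0V
  have hJ₀ := hJsq 0 h0V
  set w : ℂ → E := fun z ↦ v z - J 0 (J z (v z)) with hw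
  set R : ℂ → E →L[ℝ] E := fun z ↦ fderiv ℝ J z I - J 0 ∘L fderiv ℝ J z 1 +
    J 0 ∘L B z + J z ∘L B z with hR
  have hwd : ContDiffOn ℝ (⊤ : ℕ∞) w V := hv.sub ((J 0).contDiff.comp_contDiffOn (hJ.clm_apply hv))
  have hRc : ContinuousAt R 0 := by
    have hc := fun e ↦ ((contDiffOn_fderiv_apply hV hJ e).contDiffAt hV0).continuousAt
    have hBc := (hB.contDiffAt hV0).continuousAt
    exact (((hc I).sub (continuousAt_const.clm_comp (hc 1))).add
      (continuousAt_const.clm_comp hBc)).add ((hJ.contDiffAt hV0).continuousAt.clm_comp hBc)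
  have hder : ∀ z ∈ V, fderiv ℝ w z 1 + J 0 (fderiv ℝ w z I) = R z (v z) := by
    intro z hz
    have hvz := hasFDerivAt_of_contDiffOn hV hv hz
    have hwz := hvz.fun_sub ((J 0).hasFDerivAt.comp z
      ((hasFDerivAt_of_contDiffOn hV hJ hz).clm_apply hvz))
    have hwe : ∀ e, fderiv ℝ w z e = fderiv ℝ v z e -
        J 0 (J z (fderiv ℝ v z e) + fderiv ℝ J z e (v z)) := fun e ↦ by
      refine (DFunLike.congr_fun hwz.fderiv e).trans ?_
      simp
    rw [hwe, hwe, h z hz]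
    simp only [hR, map_add, map_sub, hJ₀, hJsq z hz, _root_.add_apply, _root_.sub_apply,
      ContinuousLinearMap.comp_apply]
    abel
  have hΘ : ∀ᶠ z in 𝓝 (0 : ℂ), ‖J 0 ∘L (J z - J 0)‖ < 1 := by
    have hc : ContinuousAt (fun z ↦ ‖J 0 ∘L (J z - J 0)‖) 0 :=
      (continuousAt_const.clm_comp
        ((hJ.contDiffAt hV0).continuousAt.sub continuousAt_const)).norm
    exact hc.eventually_lt continuousAt_const (by simp)
  have hvw : ∀ z, ‖J 0 ∘L (J z - J 0)‖ < 1 → ‖v z‖ ≤ ‖w z‖ := by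
    intro z hz
    have h1 : v z + v z = w z + (J 0 ∘L (J z - J 0)) (v z) := by
      simp only [hw, ContinuousLinearMap.comp_apply, _root_.sub_apply, map_sub, hJ₀]
      abel
    have h2 : ‖v z + v z‖ = 2 * ‖v z‖ := by rw [← two_smul ℝ, norm_smul]; simp
    have h3 := (J 0 ∘L (J z - J 0)).le_opNorm (v z)
    have h4 := norm_add_le (w z) ((J 0 ∘L (J z - J 0)) (v z))
    rw [← h1, h2] at h4
    nlinarith [norm_nonneg (v z)]
  have hRb : ∀ᶠ z in 𝓝 (0 : ℂ), ‖R z‖ < ‖R 0‖ + 1 :=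
    hRc.norm.eventually_lt continuousAt_const (by simp)
  obtain ⟨W, hW, hWo, h0W⟩ := _root_.eventually_nhds_iff.1 ((hRb.and hΘ).and hV0)
  have hw0 := eventually_eq_zero_of_flat (J 0) hJ₀ (C := ‖R 0‖ + 1) (w := w) hWo h0W
    ((hwd.mono fun z hz ↦ (hW z hz).2).of_le
      (by simpa using WithTop.coe_le_coe.2 (le_top : (2 : ℕ∞) ≤ ⊤)))
    (fun z hz ↦ by
      rw [hder z (hW z hz).2]
      refine ((R z).le_opNorm _).trans ?_
      gcongr
      · exact (hW z hz).1.1.le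
      · exact hvw z (hW z hz).1.2)
    (fun m ↦ (hflat m).sub (isBigO_continuous_clm_apply continuousAt_const
      (isBigO_continuous_clm_apply (hJ.contDiffAt hV0).continuousAt (hflat m))))
  filter_upwards [hw0, hΘ] with z hz hz'
  simpa [hz] using hvw z hz'

theorem eventually_ne_zero_or_eventually_eq_zero {J B : ℂ → E →L[ℝ] E} {v : ℂ → E} {V : Set ℂ}
    (hV : IsOpen V) (hJ : ContDiffOn ℝ (⊤ : ℕ∞) J V) (hJsq : ∀ z ∈ V, ∀ x, J z (J z x) = -x)
    (hB : ContDiffOn ℝ (⊤ : ℕ∞) B V) (hv : ContDiffOn ℝ (⊤ : ℕ∞) v V)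
    (h : ∀ z ∈ V, fderiv ℝ v z I = J z (fderiv ℝ v z 1) + B z (v z)) {z₀ : ℂ} (hz₀ : z₀ ∈ V) :
    (∀ᶠ z in 𝓝[≠] z₀, v z ≠ 0) ∨ ∀ᶠ z in 𝓝 z₀, v z = 0 := by
  set V' : Set ℂ := (· + z₀) ⁻¹' V
  have hV' : IsOpen V' := hV.preimage (by fun_prop)
  have h0V' : (0 : ℂ) ∈ V' := by simpa [V'] using hz₀
  have hadd : ContDiffOn ℝ (⊤ : ℕ∞) (fun z : ℂ ↦ z + z₀) V' := by fun_prop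
  have hmaps : MapsTo (fun z : ℂ ↦ z + z₀) V' V := fun z hz ↦ hz
  have hJ' := hJ.comp hadd hmaps
  have hB' := hB.comp hadd hmaps
  have hv' := hv.comp hadd hmaps
  have h' : ∀ z ∈ V', fderiv ℝ (fun z ↦ v (z + z₀)) z I =
      J (z + z₀) (fderiv ℝ (fun z ↦ v (z + z₀)) z 1) + B (z + z₀) (v (z + z₀)) := by
    intro z hz
    rw [fderiv_comp_add_right]
    exact h _ hz
  have hsq' : ∀ z ∈ V', ∀ x, J (z + z₀) (J (z + z₀) x) = -x := fun z hz ↦ hJsq _ hz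
  have htend : Tendsto (fun z ↦ z - z₀) (𝓝 z₀) (𝓝 0) :=
    tendsto_sub_nhds_zero_iff.2 tendsto_id
  rcases eventually_ne_zero_or_flat hV' h0V' hJ' (hsq' 0 h0V') hB' hv' h' with hne | hflat
  · left
    rw [eventually_nhdsWithin_iff] at hne ⊢
    filter_upwards [htend.eventually hne] with z hz hz0
    simpa using hz (sub_ne_zero.2 hz0)
  · right
    filter_upwards [htend.eventually
      (eventually_eq_zero_of_flat_of_eq hV' h0V' hJ' hsq' hB' hv' h' hflat)] with z hz
    simpa using hz

theorem fderiv_apply_one_eventually_ne_zero_or_eventually_eq_zero {J : E → E →L[ℝ] E}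
    (hJ : ContDiff ℝ (⊤ : ℕ∞) J) (hJsq : ∀ x v, J x (J x v) = -v) {U : Set ℂ} (hU : IsOpen U)
    {u : ℂ → E} (hu : ContDiffOn ℝ (⊤ : ℕ∞) u U)
    (huJ : ∀ z ∈ U, fderiv ℝ u z I = J (u z) (fderiv ℝ u z 1)) {z₀ : ℂ} (hz₀ : z₀ ∈ U) :
    (∀ᶠ z in 𝓝[≠] z₀, fderiv ℝ u z 1 ≠ 0) ∨ ∀ᶠ z in 𝓝 z₀, fderiv ℝ u z 1 = 0 := by
  have hv := contDiffOn_fderiv_apply hU hu 1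
  have hDJ : ContDiff ℝ (⊤ : ℕ∞) (fderiv ℝ J) := hJ.fderiv_right (by simp)
  refine eventually_ne_zero_or_eventually_eq_zero (J := fun z ↦ J (u z))
    (B := fun z ↦ fderiv ℝ J (u z) (fderiv ℝ u z 1)) hU (hJ.comp_contDiffOn hu)
    (fun z _ ↦ hJsq (u z)) ((hDJ.comp_contDiffOn hu).clm_apply hv) hv (fun z hz ↦ ?_) hz₀
  have huz := hasFDerivAt_of_contDiffOn hU hu hz
  have hJu := ((hJ.differentiable (by simp) (u z)).hasFDerivAt).comp z huz
  have heq : (fun z ↦ fderiv ℝ u z I) =ᶠ[𝓝 z] fun z ↦ J (u z) (fderiv ℝ u z 1) :=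
    eventually_of_mem (hU.mem_nhds hz) huJ
  rw [fderiv_fderiv_apply_comm hU hu hz 1 I,
    ((hJu.clm_apply (hasFDerivAt_of_contDiffOn hU hv hz)).congr_of_eventuallyEq heq).fderiv]
  simp

theorem not_accPt_fderiv_eq_zero {J : E → E →L[ℝ] E} (hJ : ContDiff ℝ (⊤ : ℕ∞) J)
    (hJsq : ∀ x v, J x (J x v) = -v) {U : Set ℂ} (hU : IsOpen U) (hUc : IsPreconnected U)
    {u : ℂ → E} (hu : ContDiffOn ℝ (⊤ : ℕ∞) u U)
    (huJ : ∀ z ∈ U, fderiv ℝ u z 1 + J (u z) (fderiv ℝ u z I) = 0)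
    (hne : ∃ z ∈ U, ∃ w ∈ U, u z ≠ u w) {z₀ : ℂ} (hz₀ : z₀ ∈ U) :
    ¬ AccPt z₀ (𝓟 {w | w ∈ U ∧ fderiv ℝ u w = 0}) := by
  have huJ' : ∀ z ∈ U, fderiv ℝ u z I = J (u z) (fderiv ℝ u z 1) := fun z hz ↦ by
    rw [eq_neg_of_add_eq_zero_left (huJ z hz), map_neg, hJsq, neg_neg]
  have hdich := fun z (hz : z ∈ U) ↦
    fderiv_apply_one_eventually_ne_zero_or_eventually_eq_zero hJ hJsq hU hu huJ' hz
  intro hacc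
  have hcrit : ∃ᶠ z in 𝓝[≠] z₀, fderiv ℝ u z 1 = 0 :=
    (accPt_iff_frequently_nhdsNE.1 hacc).mono fun z hz ↦ by simp [hz.2]
  have h0 := (hdich z₀ hz₀).resolve_left hcrit
  set S : Set ℂ := {z | ∀ᶠ y in 𝓝 z, fderiv ℝ u y 1 = 0}
  have hSo : IsOpen S := isOpen_setOfPred_eventually_nhds
  have hUS : U ⊆ S := by
    refine hUc.subset_of_closure_inter_subset hSo ⟨z₀, hz₀, h0⟩ fun z hz ↦ ?_
    by_contra hzS
    have hz' := (hdich z hz.2).resolve_right hzS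
    rw [eventually_nhdsWithin_iff] at hz'
    obtain ⟨y, hy, hyS⟩ := mem_closure_iff_nhds.1 hz.1 _ (eventually_eventually_nhds.2 hz')
    exact hy.self_of_nhds (fun hyz ↦ hzS (hyz ▸ hyS)) hyS.self_of_nhds
  obtain ⟨z, hz, w, hw, hzw⟩ := hne
  exact hzw (hU.is_const_of_fderiv_eq_zero hUc (hu.differentiableOn (by simp))
    (fun y hy ↦ fderiv_eq_zero_of_apply_one_eq_zero (huJ' y hy) (hUS hy).self_of_nhds) hz hw)

end UniqueContinuation

end PseudoholomorphicCurves

/-- **Isolated critical points.**  Let `J` be an almost complex structure on `ℂⁿ`,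
`U ⊆ ℂ` a connected open set, and `u : U → ℂⁿ` a smooth nonconstant `J`-holomorphic
curve.  Then the critical set `{z ∈ U : Du(z) = 0}` has no accumulation point in `U`. -/
theorem pseudoholomorphic_critical_points_isolated (n : ℕ)
    (J : EuclideanSpace ℂ (Fin n) →
      (EuclideanSpace ℂ (Fin n) →L[ℝ] EuclideanSpace ℂ (Fin n)))
    (hJsmooth : ContDiff ℝ (⊤ : ℕ∞) J)
    (hJsq : ∀ x v, J x (J x v) = -v)
    (U : Set ℂ) (hU : IsOpen U) (hUconn : IsConnected U)
    (u : ℂ → EuclideanSpace ℂ (Fin n))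
    (husmooth : ContDiffOn ℝ (⊤ : ℕ∞) u U)
    (huCR : ∀ z ∈ U, fderiv ℝ u z 1 + J (u z) (fderiv ℝ u z Complex.I) = 0)
    (hnonconst : ∃ z ∈ U, ∃ w ∈ U, u z ≠ u w) :
    ∀ z ∈ U, ¬ AccPt z (Filter.principal {w | w ∈ U ∧ fderiv ℝ u w = 0}) := by
  exact fun z hz ↦
    not_accPt_fderiv_eq_zero hJsmooth hJsq hU hUconn.isPreconnected husmooth huCR hnonconst hz
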